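/- (One-tail regime, stable case of the generator convergence.) Fix d ≥ 1, u₀ > 0, p ∈ [1,∞], and parameters a ∈ (0,2), b ∈ [0,1). For δ ∈ (0,1) define, for twice continuously differentiable φ : ℝ^d → ℝ with max_{|κ|≤2} ‖∂_κ φ‖_p < ∞, L^δ φ(x) := u₀ V₁ ∫_δ^∞ ( φ̄̄(x, δ^{1−b} r^b, r) − φ(x) ) dr/r^{1+a} and D^δ φ(x) := u₀ V₁ ∫_δ^∞ ( φ̄(x,r) − φ(x) ) dr/r^{1+a}. Then there exist constants C > 0 and θ > 0 such that for all δ ∈ (0,1) and all such φ: ‖ L^δ φ − D^δ φ ‖_p ≤ C δ^θ max_{|κ|≤2} ‖∂_κ φ‖_p. -/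

import Mathlib

open MeasureTheory Metric Set
open scoped ENNReal

noncomputable section

/-- Euclidean space `ℝ^d`. -/
abbrev Euc (d : ℕ) : Type := EuclideanSpace ℝ (Fin d)

/-- The ball average `φ̄(x,r) = (1/V_r) ∫_{B(x,r)} φ(y) dy` (with `φ̄(x,0) = φ(x)`). -/
def ballAvg {d : ℕ} (φ : Euc d → ℝ) (r : ℝ) (x : Euc d) : ℝ :=
  if r = 0 then φ x
  else ((volume (Metric.ball x r)).toReal)⁻¹ * ∫ y in Metric.ball x r, φ y

/-- The double ball average `φ̄̄(x,r,s) = (1/(V_r V_s)) ∫_{B(x,r)} ∫_{B(y,s)} φ(z) dz dy`. -/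
def doubleAvg {d : ℕ} (φ : Euc d → ℝ) (r s : ℝ) (x : Euc d) : ℝ :=
  ballAvg (ballAvg φ s) r x

/-- Partial derivative of `ψ` in the `i`-th coordinate direction. -/
def pd {d : ℕ} (i : Fin d) (ψ : Euc d → ℝ) (x : Euc d) : ℝ :=
  fderiv ℝ ψ x (EuclideanSpace.single i 1)

/-- Iterated partial derivative `∂_κ` along a list of coordinate directions. -/
def listD {d : ℕ} : List (Fin d) → (Euc d → ℝ) → Euc d → ℝ
  | [], ψ => ψ
  | i :: l, ψ => pd i (listD l ψ)

/-- The Laplacian `Δφ = ∑ i ∂²φ/∂x_i²`. -/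
def lap {d : ℕ} (φ : Euc d → ℝ) (x : Euc d) : ℝ := ∑ i : Fin d, listD [i, i] φ x

/-- The volume of the unit ball in `ℝ^d`. -/
def V1 (d : ℕ) : ℝ := (volume (Metric.ball (0 : Euc d) 1)).toReal

/-- `max_{|κ| ≤ n} ‖∂_κ φ‖_p`. -/
def maxDle {d : ℕ} (n : ℕ) (φ : Euc d → ℝ) (p : ℝ≥0∞) : ℝ≥0∞ :=
  ⨆ (l : List (Fin d)) (_ : l.length ≤ n), eLpNorm (listD l φ) p volume


/-- Uniform probability measure on the open unit ball. -/
def nu (d : ℕ) : Measure (Euc d) :=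
  (volume (Metric.ball (0 : Euc d) 1))⁻¹ • volume.restrict (Metric.ball (0 : Euc d) 1)

lemma vol_ball_ne_zero (d : ℕ) (x : Euc d) {r : ℝ} (hr : 0 < r) : volume (Metric.ball x r) ≠ 0 :=
  (Metric.measure_ball_pos volume x hr).ne'

instance nu_prob (d : ℕ) : IsProbabilityMeasure (nu d) := by
  constructor
  simp only [nu, Measure.smul_apply, Measure.restrict_apply_univ, smul_eq_mul]
  exact ENNReal.inv_mul_cancel (vol_ball_ne_zero d 0 one_pos) measure_ball_lt_top.ne

lemma nu_ae (d : ℕ) : ∀ᵐ z ∂(nu d), z ∈ Metric.ball (0 : Euc d) 1 :=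
  Measure.ae_smul_measure (ae_restrict_mem measurableSet_ball) _

lemma nu_restrict (d : ℕ) : (nu d).restrict (Metric.closedBall (0 : Euc d) 1) = nu d := by
  apply Measure.restrict_eq_self_of_ae_mem
  filter_upwards [nu_ae d] with z hz using Metric.ball_subset_closedBall hz

lemma nu_continuous {d : ℕ} {X : Type*} [TopologicalSpace X] [FirstCountableTopology X]
    [LocallyCompactSpace X] {f : X → Euc d → ℝ} (hf : Continuous (Function.uncurry f)) :
    Continuous (fun x => ∫ y, f x y ∂(nu d)) := by
  have := continuous_parametric_integral_of_continuous (μ := nu d) hf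
    (isCompact_closedBall (0 : Euc d) 1)
  simpa only [nu_restrict] using this

lemma nu_integrable {d : ℕ} {f : Euc d → ℝ} (hf : Continuous f) : Integrable f (nu d) := by
  have := hf.continuousOn.integrableOn_compact (μ := nu d) (isCompact_closedBall (0 : Euc d) 1)
  rwa [IntegrableOn, nu_restrict] at this

lemma nu_prod_integrable {d : ℕ} {f : Euc d × Euc d → ℝ} (hf : Continuous f) :
    Integrable f ((nu d).prod (nu d)) := by
  have := hf.continuousOn.integrableOn_compact (μ := (nu d).prod (nu d))
    ((isCompact_closedBall (0 : Euc d) 1).prod (isCompact_closedBall (0 : Euc d) 1))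
  rwa [IntegrableOn, ← Measure.prod_restrict, nu_restrict] at this

lemma nu_neg {d : ℕ} (f : Euc d → ℝ) : ∫ z, f (-z) ∂(nu d) = ∫ z, f z ∂(nu d) := by
  simp only [nu, integral_smul_measure]
  congr 1
  rw [← integral_indicator measurableSet_ball, ← integral_indicator measurableSet_ball,
    ← integral_neg_eq_self]
  congr 1
  ext x
  simp [Set.indicator]

lemma ballAvg_eq {d : ℕ} (φ : Euc d → ℝ) {r : ℝ} (hr : 0 ≤ r) (x : Euc d) :
    ballAvg φ r x = ∫ z, φ (x + r • z) ∂(nu d) := by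
  rcases hr.eq_or_lt with rfl | hr
  · simp [ballAvg]
  · have h1 := Measure.setIntegral_comp_smul (volume : Measure (Euc d)) (fun z => φ (x + z))
      (Metric.ball (0 : Euc d) 1) hr.ne'
    have h2 : ∫ z in Metric.ball (0 : Euc d) r, φ (x + z) = ∫ y in Metric.ball x r, φ y := by
      rw [← integral_indicator measurableSet_ball, ← integral_indicator measurableSet_ball,
        ← integral_add_left_eq_self (fun y => (Metric.ball x r).indicator φ y) x]
      congr 1
      ext z
      simp [Set.indicator]
    have h3 : volume (Metric.ball x r) = ENNReal.ofReal (r ^ d) * volume (Metric.ball (0 : Euc d) 1) := by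
      have := Measure.addHaar_ball_of_pos (volume : Measure (Euc d)) x hr
      simpa using this
    rw [smul_unitBall_of_pos hr, h2] at h1
    have hrd : 0 < r ^ d := by positivity
    rw [ballAvg, if_neg hr.ne', h3, nu, integral_smul_measure, h1]
    simp only [finrank_euclideanSpace, Fintype.card_fin, smul_eq_mul, ENNReal.toReal_mul,
      ENNReal.toReal_ofReal hrd.le, ENNReal.toReal_inv, abs_of_pos (inv_pos.2 hrd)]
    rw [mul_inv]; ring

/-- Minkowski type inequality. -/
lemma minkowski {α E : Type*} [MeasurableSpace α] [MeasurableSpace E] (μ : Measure α)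
    [IsFiniteMeasure μ] (ρ : Measure E) [SFinite ρ] (f : α → E → ℝ)
    (hf : Measurable (Function.uncurry f)) (p : ℝ≥0∞) (hp : 1 ≤ p) (K : ℝ≥0∞)
    (hK : ∀ᵐ r ∂μ, eLpNorm (f r) p ρ ≤ K) :
    eLpNorm (fun x => ∫ r, f r x ∂μ) p ρ ≤ μ univ * K := by
  rcases eq_or_ne p ⊤ with rfl | hpt
  · rw [eLpNorm_exponent_top]
    apply eLpNormEssSup_le_of_ae_enorm_bound
    have h1 : ∀ᵐ r ∂μ, ∀ᵐ x ∂ρ, ‖f r x‖ₑ ≤ K := by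
      filter_upwards [hK] with r hr
      rw [eLpNorm_exponent_top] at hr
      filter_upwards [enorm_ae_le_eLpNormEssSup (f r) ρ] with x hx using hx.trans hr
    have hms : MeasurableSet {x : α × E | ‖f x.1 x.2‖ₑ ≤ K} :=
      measurableSet_le hf.enorm measurable_const
    rw [Measure.ae_ae_comm (p := fun r x => ‖f r x‖ₑ ≤ K) hms] at h1
    filter_upwards [h1] with x hx
    calc _ ≤ ∫⁻ r, ‖f r x‖ₑ ∂μ := enorm_integral_le_lintegral_enorm _
      _ ≤ ∫⁻ r, K ∂μ := lintegral_mono_ae hx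
      _ = _ := by rw [lintegral_const, mul_comm]
  · have hp0 : p ≠ 0 := (zero_lt_one.trans_le hp).ne'
    set q := p.toReal with hq
    have hq1 : 1 ≤ q := by
      rw [hq, ← ENNReal.toReal_one]; exact ENNReal.toReal_mono hpt hp
    have hq0 : 0 < q := by linarith
    have hpow : ∀ᵐ r ∂μ, ∫⁻ x, ‖f r x‖ₑ ^ q ∂ρ ≤ K ^ q := by
      filter_upwards [hK] with r hr
      rw [eLpNorm_eq_lintegral_rpow_enorm_toReal hp0 hpt, ← hq] at hr
      have := ENNReal.rpow_le_rpow hr hq0.le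
      rwa [← ENNReal.rpow_mul, one_div, inv_mul_cancel₀ hq0.ne', ENNReal.rpow_one] at this
    have hx : ∀ x, ‖∫ r, f r x ∂μ‖ₑ ^ q ≤ (μ univ) ^ (q - 1) * ∫⁻ r, ‖f r x‖ₑ ^ q ∂μ := by
      intro x
      have hm : AEStronglyMeasurable (fun r => f r x) μ :=
        (hf.comp (measurable_id.prodMk measurable_const)).aestronglyMeasurable
      have h2 := eLpNorm_le_eLpNorm_mul_rpow_measure_univ hp hm
      rw [eLpNorm_one_eq_lintegral_enorm, eLpNorm_eq_lintegral_rpow_enorm_toReal hp0 hpt, ← hq] at h2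
      have h3 := (enorm_integral_le_lintegral_enorm (μ := μ) (fun r => f r x)).trans h2
      have := ENNReal.rpow_le_rpow h3 hq0.le
      rw [ENNReal.mul_rpow_of_nonneg _ _ hq0.le, ← ENNReal.rpow_mul, ← ENNReal.rpow_mul,
        one_div q, inv_mul_cancel₀ hq0.ne', ENNReal.rpow_one, mul_comm] at this
      convert this using 3
      simp; field_simp
    rw [eLpNorm_eq_lintegral_rpow_enorm_toReal hp0 hpt, ← hq]
    have hfin : μ univ ^ (q - 1) ≠ ⊤ := ENNReal.rpow_ne_top_of_nonneg (by linarith) (measure_ne_top _ _)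
    have h4 : ∫⁻ x, ‖∫ r, f r x ∂μ‖ₑ ^ q ∂ρ ≤ (μ univ * K) ^ q := by
      calc _ ≤ ∫⁻ x, (μ univ) ^ (q - 1) * ∫⁻ r, ‖f r x‖ₑ ^ q ∂μ ∂ρ := lintegral_mono hx
        _ = (μ univ) ^ (q - 1) * ∫⁻ x, ∫⁻ r, ‖f r x‖ₑ ^ q ∂μ ∂ρ := lintegral_const_mul' _ _ hfin
        _ = (μ univ) ^ (q - 1) * ∫⁻ r, ∫⁻ x, ‖f r x‖ₑ ^ q ∂ρ ∂μ := by
            rw [lintegral_lintegral_swap]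
            exact ((hf.comp measurable_swap).enorm.pow_const q).aemeasurable
        _ ≤ (μ univ) ^ (q - 1) * ∫⁻ r, K ^ q ∂μ := by gcongr 1; exact lintegral_mono_ae hpow
        _ = (μ univ) ^ (q - 1) * (μ univ) ^ (1 : ℝ) * K ^ q := by
            rw [lintegral_const, ENNReal.rpow_one]; ring
        _ = _ := by
            rw [← ENNReal.rpow_add_of_nonneg _ _ (by linarith) zero_le_one,
              ENNReal.mul_rpow_of_nonneg _ _ hq0.le]
            congr 2; ring
    have := ENNReal.rpow_le_rpow h4 (z := 1 / q) (by positivity)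
    rwa [← ENNReal.rpow_mul _ q, mul_one_div_cancel hq0.ne', ENNReal.rpow_one] at this

lemma pd_sum {d : ℕ} (ψ : Euc d → ℝ) (x h : Euc d) :
    fderiv ℝ ψ x h = ∑ i, h i * pd i ψ x := by
  have hh : h = ∑ i, h i • EuclideanSpace.single i (1 : ℝ) := by
    have := (EuclideanSpace.basisFun (Fin d) ℝ).sum_repr h
    simpa using this.symm
  conv_lhs => rw [hh]
  simp [pd, map_sum]

lemma hasDerivAt_line {d : ℕ} {ψ : Euc d → ℝ} (hψ : Differentiable ℝ ψ) (y h : Euc d) (t : ℝ) :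
    HasDerivAt (fun t : ℝ => ψ (y + t • h)) (∑ i, h i * pd i ψ (y + t • h)) t := by
  rw [← pd_sum]
  have h1 : HasDerivAt (fun t : ℝ => y + t • h) h t := by
    simpa using ((hasDerivAt_id t).smul_const h).const_add y
  exact (hψ (y + t • h)).hasFDerivAt.comp_hasDerivAt t h1

lemma pd_contDiff {d : ℕ} {ψ : Euc d → ℝ} (i : Fin d) {n : ℕ} (hψ : ContDiff ℝ (n + 1 : ℕ) ψ) :
    ContDiff ℝ n (pd i ψ) := by
  unfold pd
  exact (hψ.fderiv_right (m := n) (by norm_cast)).clm_apply contDiff_const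

/-- Remainder in the second-order Taylor formula. -/
def rem2 {d : ℕ} (φ : Euc d → ℝ) (h y : Euc d) (t : ℝ) : ℝ :=
  (1 - t) * ∑ i, ∑ j, h i * h j * listD [j, i] φ (y + t • h)

lemma listD2_cont {d : ℕ} {φ : Euc d → ℝ} (hφ : ContDiff ℝ 2 φ) (i j : Fin d) :
    Continuous (listD [j, i] φ) := by
  have h1 : ContDiff ℝ 1 (pd i φ) := by
    have := pd_contDiff (n := 1) i (ψ := φ) (by exact_mod_cast hφ)
    exact_mod_cast this
  have h2 : ContDiff ℝ 0 (pd j (pd i φ)) := by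
    have := pd_contDiff (n := 0) j (ψ := pd i φ) (by exact_mod_cast h1)
    exact_mod_cast this
  exact h2.continuous

lemma rem2_cont {d : ℕ} {φ : Euc d → ℝ} (hφ : ContDiff ℝ 2 φ) :
    Continuous (fun q : Euc d × Euc d × ℝ => rem2 φ q.1 q.2.1 q.2.2) := by
  unfold rem2
  have := fun i j => listD2_cont hφ i j
  fun_prop

lemma taylor2 {d : ℕ} {φ : Euc d → ℝ} (hφ : ContDiff ℝ 2 φ) (h y : Euc d) :
    φ (y + h) - φ y = fderiv ℝ φ y h + ∫ t in (0 : ℝ)..1, rem2 φ h y t := by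
  have h1 : ∀ i, Differentiable ℝ (pd i φ) := by
    intro i
    have := pd_contDiff (n := 1) i (ψ := φ) (by exact_mod_cast hφ)
    exact this.differentiable (by norm_num)
  have hd : ∀ t ∈ uIcc (0 : ℝ) 1, HasDerivAt
      (fun t : ℝ => (1 - t) * (∑ i, h i * pd i φ (y + t • h)) + φ (y + t • h))
      (rem2 φ h y t) t := by
    intro t _
    have e1 := hasDerivAt_line (hφ.differentiable (by norm_num)) y h t
    have e2 : HasDerivAt (fun t : ℝ => ∑ i, h i * pd i φ (y + t • h))
        (∑ i, h i * ∑ j, h j * pd j (pd i φ) (y + t • h)) t :=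
      HasDerivAt.fun_sum fun i _ => (hasDerivAt_line (h1 i) y h t).const_mul (h i)
    have e3 := (((hasDerivAt_id t).const_sub 1).mul e2).add e1
    refine e3.congr_deriv ?_
    simp only [rem2, listD, Finset.mul_sum, id, mul_assoc]
    simp only [neg_mul, one_mul, Finset.sum_neg_distrib]
    ring
  have hc : Continuous (rem2 φ h y) :=
    (rem2_cont hφ).comp (f := fun t : ℝ => (h, y, t)) (by fun_prop)
  have := intervalIntegral.integral_eq_sub_of_hasDerivAt hd (hc.intervalIntegrable 0 1)
  rw [this, pd_sum]
  simp only [one_smul, zero_smul, add_zero]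
  ring

/-- `A_ε φ - φ`. -/
def gap {d : ℕ} (φ : Euc d → ℝ) (ε : ℝ) (y : Euc d) : ℝ :=
  ∫ z, (φ (y + ε • z) - φ y) ∂(nu d)

lemma nu_linear {d : ℕ} (l : Euc d →L[ℝ] ℝ) : ∫ z, l z ∂(nu d) = 0 := by
  have := nu_neg (fun z => l z)
  simp only [map_neg, integral_neg] at this
  linarith

lemma gap_eq {d : ℕ} {φ : Euc d → ℝ} (hφ : ContDiff ℝ 2 φ) (ε : ℝ) (y : Euc d) :
    gap φ ε y = ∫ z, (∫ t in (0 : ℝ)..1, rem2 φ (ε • z) y t) ∂(nu d) := by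
  unfold gap
  simp_rw [taylor2 hφ]
  rw [integral_add]
  · simp [integral_const_mul, nu_linear]
  · exact nu_integrable (by fun_prop)
  · apply nu_integrable
    apply intervalIntegral.continuous_parametric_intervalIntegral_of_continuous'
    exact (rem2_cont hφ).comp (f := fun q : Euc d × ℝ => (ε • q.1, y, q.2)) (by fun_prop)

lemma le_maxDle {d : ℕ} (φ : Euc d → ℝ) (p : ℝ≥0∞) (l : List (Fin d)) (hl : l.length ≤ 2) :
    eLpNorm (listD l φ) p volume ≤ maxDle 2 φ p :=
  le_iSup₂ (f := fun (l : List (Fin d)) (_ : l.length ≤ 2) => eLpNorm (listD l φ) p volume) l hl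

lemma eLpNorm_translate {d : ℕ} {ψ : Euc d → ℝ} (hψ : Continuous ψ) (p : ℝ≥0∞) (h : Euc d) :
    eLpNorm (fun y => ψ (y + h)) p volume = eLpNorm ψ p volume :=
  eLpNorm_comp_measurePreserving hψ.aestronglyMeasurable (measurePreserving_add_right volume h)

lemma rem2_norm {d : ℕ} {φ : Euc d → ℝ} (hφ : ContDiff ℝ 2 φ) (p : ℝ≥0∞) (hp : 1 ≤ p)
    {ε : ℝ} (hε : 0 ≤ ε) (z : Euc d) (hz : ‖z‖ ≤ 1) (t : ℝ) (ht : t ∈ Icc (0 : ℝ) 1) :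
    eLpNorm (fun y => rem2 φ (ε • z) y t) p volume ≤
      ENNReal.ofReal (d ^ 2 * ε ^ 2) * maxDle 2 φ p := by
  have e : (fun y => rem2 φ (ε • z) y t) = ∑ i, ∑ j,
      ((1 - t) * ((ε • z) i * (ε • z) j)) • (fun y => listD [j, i] φ (y + t • ε • z)) := by
    ext y
    simp only [rem2, Finset.sum_apply, Pi.smul_apply, smul_eq_mul, Finset.mul_sum]
    refine Finset.sum_congr rfl fun i _ => Finset.sum_congr rfl fun j _ => by ring
  have hm : ∀ i j, AEStronglyMeasurable (((1 - t) * ((ε • z) i * (ε • z) j)) •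
      (fun y => listD [j, i] φ (y + t • ε • z))) volume := fun i j => by
    have := listD2_cont hφ i j
    apply Continuous.aestronglyMeasurable
    fun_prop
  have hb : ∀ i j, eLpNorm (((1 - t) * ((ε • z) i * (ε • z) j)) •
      (fun y => listD [j, i] φ (y + t • ε • z))) p volume ≤
        ENNReal.ofReal (ε ^ 2) * maxDle 2 φ p := fun i j => by
    rw [eLpNorm_const_smul, eLpNorm_translate (listD2_cont hφ i j)]
    refine mul_le_mul' ?_ (le_maxDle φ p [j, i] le_rfl)
    rw [Real.enorm_eq_ofReal_abs]
    apply ENNReal.ofReal_le_ofReal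
    have hi : |z i| ≤ 1 := (PiLp.norm_apply_le z i).trans hz
    have hj : |z j| ≤ 1 := (PiLp.norm_apply_le z j).trans hz
    have ht' : |1 - t| ≤ 1 := by rw [abs_le]; constructor <;> linarith [ht.1, ht.2]
    simp only [PiLp.smul_apply, smul_eq_mul, abs_mul, abs_of_nonneg hε]
    calc |1 - t| * (ε * |z i| * (ε * |z j|)) ≤ 1 * (ε * 1 * (ε * 1)) := by gcongr
      _ = ε ^ 2 := by ring
  rw [e]
  calc _ ≤ ∑ i : Fin d, eLpNorm (∑ j, ((1 - t) * ((ε • z) i * (ε • z) j)) •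
        (fun y => listD [j, i] φ (y + t • ε • z))) p volume :=
        eLpNorm_sum_le (fun i _ => Finset.aestronglyMeasurable_sum _ fun j _ => hm i j) hp
    _ ≤ ∑ i : Fin d, ∑ j : Fin d, ENNReal.ofReal (ε ^ 2) * maxDle 2 φ p :=
        Finset.sum_le_sum fun i _ => (eLpNorm_sum_le (fun j _ => hm i j) hp).trans
          (Finset.sum_le_sum fun j _ => hb i j)
    _ = _ := by
        simp only [Finset.sum_const, Finset.card_univ, Fintype.card_fin, nsmul_eq_mul]
        rw [ENNReal.ofReal_mul (by positivity), ENNReal.ofReal_pow (Nat.cast_nonneg d),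
          ENNReal.ofReal_natCast]
        ring

lemma gap_norm2 {d : ℕ} {φ : Euc d → ℝ} (hφ : ContDiff ℝ 2 φ) (p : ℝ≥0∞) (hp : 1 ≤ p)
    {ε : ℝ} (hε : 0 ≤ ε) :
    eLpNorm (gap φ ε) p volume ≤ ENNReal.ofReal (d ^ 2 * ε ^ 2) * maxDle 2 φ p := by
  have e : gap φ ε = fun y => ∫ z, (∫ t in (0 : ℝ)..1, rem2 φ (ε • z) y t) ∂(nu d) :=
    funext (gap_eq hφ ε)
  rw [e]
  have hc : Continuous (fun q : (Euc d × Euc d) => ∫ t in (0 : ℝ)..1, rem2 φ (ε • q.1) q.2 t) := by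
    apply intervalIntegral.continuous_parametric_intervalIntegral_of_continuous'
    exact (rem2_cont hφ).comp (f := fun q : (Euc d × Euc d) × ℝ => (ε • q.1.1, q.1.2, q.2))
      (by fun_prop)
  have := minkowski (nu d) volume (fun z y => ∫ t in (0 : ℝ)..1, rem2 φ (ε • z) y t)
    hc.measurable p hp (ENNReal.ofReal (d ^ 2 * ε ^ 2) * maxDle 2 φ p) ?_
  · simpa using this
  filter_upwards [nu_ae d] with z hz
  have hz' : ‖z‖ ≤ 1 := by simpa using (Metric.ball_subset_closedBall hz)
  have hc2 : Continuous (fun q : (ℝ × Euc d) => rem2 φ (ε • z) q.2 q.1) :=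
    (rem2_cont hφ).comp (f := fun q : ℝ × Euc d => (ε • z, q.2, q.1)) (by fun_prop)
  have := minkowski ((volume : Measure ℝ).restrict (Ioc 0 1)) volume
    (fun t y => rem2 φ (ε • z) y t) hc2.measurable p hp
    (ENNReal.ofReal (d ^ 2 * ε ^ 2) * maxDle 2 φ p) (by
      filter_upwards [ae_restrict_mem measurableSet_Ioc] with t ht
      exact rem2_norm hφ p hp hε z hz' t ⟨ht.1.le, ht.2⟩)
  simp only [intervalIntegral.integral_of_le zero_le_one]
  simpa using this

lemma gap_norm0 {d : ℕ} {φ : Euc d → ℝ} (hφ : Continuous φ) (p : ℝ≥0∞) (hp : 1 ≤ p) (ε : ℝ) :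
    eLpNorm (gap φ ε) p volume ≤ 2 * maxDle 2 φ p := by
  have hc : Continuous (fun q : (Euc d × Euc d) => φ (q.2 + ε • q.1) - φ q.2) := by fun_prop
  have := minkowski (nu d) volume (fun z y => φ (y + ε • z) - φ y)
    hc.measurable p hp (2 * maxDle 2 φ p) ?_
  · rw [measure_univ, one_mul] at this
    exact this
  filter_upwards with z
  have h0 : eLpNorm φ p volume ≤ maxDle 2 φ p := le_maxDle φ p [] (by simp)
  refine (eLpNorm_sub_le (f := fun y => φ (y + ε • z)) (g := φ)
    (by apply Continuous.aestronglyMeasurable; fun_prop) hφ.aestronglyMeasurable hp).trans ?_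
  rw [eLpNorm_translate hφ, two_mul]
  gcongr

lemma gap_norm {d : ℕ} {φ : Euc d → ℝ} (hφ : ContDiff ℝ 2 φ) (p : ℝ≥0∞) (hp : 1 ≤ p)
    {ε : ℝ} (hε : 0 < ε) {s : ℝ} (hs0 : 0 ≤ s) (hs2 : s ≤ 2) :
    eLpNorm (gap φ ε) p volume ≤ ENNReal.ofReal ((2 + d ^ 2) * ε ^ s) * maxDle 2 φ p := by
  rcases le_total ε 1 with h | h
  · refine (gap_norm2 hφ p hp hε.le).trans ?_
    gcongr
    · linarith
    · rw [← Real.rpow_natCast]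
      exact Real.rpow_le_rpow_of_exponent_ge hε h (by simpa using hs2)
  · refine (gap_norm0 hφ.continuous p hp ε).trans ?_
    gcongr
    rw [show (2 : ℝ≥0∞) = ENNReal.ofReal 2 by simp]
    apply ENNReal.ofReal_le_ofReal
    have := Real.one_le_rpow h hs0
    nlinarith [sq_nonneg (d : ℝ)]

lemma gap_cont {d : ℕ} {φ : Euc d → ℝ} (hφ : Continuous φ) :
    Continuous (fun q : ℝ × Euc d => gap φ q.1 q.2) := by
  unfold gap
  apply nu_continuous
  fun_prop

/-- `A_r (A_ε φ - φ)`. -/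
def dgap {d : ℕ} (φ : Euc d → ℝ) (ε r : ℝ) (x : Euc d) : ℝ :=
  ∫ w, gap φ ε (x + r • w) ∂(nu d)

lemma dgap_cont {d : ℕ} {φ : Euc d → ℝ} (hφ : Continuous φ) :
    Continuous (fun q : ℝ × ℝ × Euc d => dgap φ q.1 q.2.1 q.2.2) := by
  unfold dgap
  apply nu_continuous
  exact (gap_cont hφ).comp (f := fun q : (ℝ × ℝ × Euc d) × Euc d =>
    (q.1.1, q.1.2.2 + q.1.2.1 • q.2)) (by fun_prop)

lemma dgap_norm {d : ℕ} {φ : Euc d → ℝ} (hφ : Continuous φ) (p : ℝ≥0∞) (hp : 1 ≤ p) (ε r : ℝ) :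
    eLpNorm (dgap φ ε r) p volume ≤ eLpNorm (gap φ ε) p volume := by
  have hg : Continuous (gap φ ε) := (gap_cont hφ).comp (f := fun y => (ε, y)) (by fun_prop)
  have hc : Continuous (fun q : (Euc d × Euc d) => gap φ ε (q.2 + r • q.1)) := by fun_prop
  have := minkowski (nu d) volume (fun w x => gap φ ε (x + r • w))
    hc.measurable p hp (eLpNorm (gap φ ε) p volume) (by
      filter_upwards with w
      rw [eLpNorm_translate hg])
  rw [measure_univ, one_mul] at this
  exact this

lemma doubleAvg_eq {d : ℕ} (φ : Euc d → ℝ) {ε r : ℝ} (hε : 0 ≤ ε) (hr : 0 ≤ r)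
    (x : Euc d) : doubleAvg φ ε r x = ∫ z, (∫ w, φ (x + ε • z + r • w) ∂(nu d)) ∂(nu d) := by
  rw [doubleAvg, ballAvg_eq _ hε]
  simp_rw [ballAvg_eq φ hr]

lemma dgap_eq {d : ℕ} {φ : Euc d → ℝ} (hφ : Continuous φ) {ε r : ℝ} (hε : 0 ≤ ε) (hr : 0 ≤ r)
    (x : Euc d) : doubleAvg φ ε r x - ballAvg φ r x = dgap φ ε r x := by
  rw [doubleAvg_eq φ hε hr, ballAvg_eq φ hr, dgap]
  unfold gap
  rw [integral_integral_swap]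
  · rw [← integral_sub]
    · congr 1
      ext w
      rw [integral_sub]
      · simp only [integral_const, probReal_univ, one_smul]
        congr 2
        ext z
        congr 1
        abel
      · exact nu_integrable (by fun_prop)
      · exact integrable_const _
    · apply nu_integrable
      apply nu_continuous
      fun_prop
    · exact nu_integrable (by fun_prop)
  · exact nu_prod_integrable (by fun_prop)

lemma avg_bound {d : ℕ} {φ : Euc d → ℝ} (hφ : Continuous φ) (p : ℝ≥0∞) (hp : 1 ≤ p)
    (hN : eLpNorm φ p volume < ⊤) {δ : ℝ} (hδ : 0 < δ) :
    ∃ B : ℝ, ∀ r, δ ≤ r → ∀ y, |∫ z, φ (y + r • z) ∂(nu d)| ≤ B := by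
  set N := (eLpNorm φ p volume).toReal with hNdef
  have hN0 : 0 ≤ N := ENNReal.toReal_nonneg
  set vδ := (volume (Metric.ball (0 : Euc d) δ)).toReal with hvδ
  have hvδ0 : 0 < vδ := ENNReal.toReal_pos (vol_ball_ne_zero d 0 hδ) measure_ball_lt_top.ne
  refine ⟨N * (1 + vδ⁻¹), fun r hr y => ?_⟩
  have hr0 : 0 < r := hδ.trans_le hr
  rw [← ballAvg_eq φ hr0.le, ballAvg, if_neg hr0.ne']
  set V := volume (Metric.ball y r) with hV
  have hVt : V ≠ ⊤ := measure_ball_lt_top.ne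
  have hv0 : 0 < V.toReal := ENNReal.toReal_pos (vol_ball_ne_zero d y hr0) hVt
  have hvv : vδ ≤ V.toReal := by
    apply ENNReal.toReal_mono hVt
    rw [hV, Measure.addHaar_ball_center volume y]
    exact measure_mono (Metric.ball_subset_ball hr)
  have h1 : ‖∫ z in Metric.ball y r, φ z‖ₑ ≤ eLpNorm φ p volume * (1 + V) := by
    calc _ ≤ ∫⁻ z in Metric.ball y r, ‖φ z‖ₑ := enorm_integral_le_lintegral_enorm _
      _ = eLpNorm φ 1 (volume.restrict (Metric.ball y r)) := eLpNorm_one_eq_lintegral_enorm.symm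
      _ ≤ _ := eLpNorm_le_eLpNorm_mul_rpow_measure_univ hp hφ.aestronglyMeasurable
      _ ≤ _ := by
        refine mul_le_mul' (eLpNorm_mono_measure _ Measure.restrict_le_self) ?_
        rw [Measure.restrict_apply_univ, ← hV]
        have ht0 : 0 ≤ 1 / (1 : ℝ≥0∞).toReal - 1 / p.toReal := by
          rcases eq_or_ne p ⊤ with rfl | hpt
          · simp
          · have : 1 ≤ p.toReal := by
              rw [← ENNReal.toReal_one]; exact ENNReal.toReal_mono hpt hp
            have := (div_le_one (by linarith)).2 this
            simpa using this
        have ht1 : 1 / (1 : ℝ≥0∞).toReal - 1 / p.toReal ≤ 1 := by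
          have : 0 ≤ 1 / p.toReal := by positivity
          simpa using this
        rcases le_total V 1 with h | h
        · exact (ENNReal.rpow_le_one h ht0).trans le_self_add
        · calc _ ≤ V ^ (1 : ℝ) := ENNReal.rpow_le_rpow_of_exponent_le h ht1
            _ = V := ENNReal.rpow_one _
            _ ≤ _ := le_add_self
  have h2 : |∫ z in Metric.ball y r, φ z| ≤ N * (1 + V.toReal) := by
    have := ENNReal.toReal_mono (by finiteness) h1
    rw [ENNReal.toReal_mul, ENNReal.toReal_add (by simp) hVt] at this
    simpa using this
  rw [abs_mul, abs_of_pos (inv_pos.2 hv0)]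
  calc _ ≤ V.toReal⁻¹ * (N * (1 + V.toReal)) := by gcongr
    _ = N * (1 + V.toReal⁻¹) := by field_simp; ring
    _ ≤ _ := by gcongr

lemma tail_integrable {g : ℝ → ℝ} (hg : Continuous g) {B δ a : ℝ} (hδ : 0 < δ) (ha : 0 < a)
    (hB : ∀ r, δ ≤ r → |g r| ≤ B) :
    IntegrableOn (fun r => g r / r ^ (1 + a)) (Ioi δ) := by
  have h := (integrableOn_Ioi_rpow_of_lt (a := -(1 + a)) (by linarith) hδ).const_mul B
  refine Integrable.mono' h ?_ ?_
  · exact (hg.measurable.div (measurable_id.pow_const (1 + a))).aestronglyMeasurable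
  · filter_upwards [ae_restrict_mem measurableSet_Ioi] with r hr
    have hr0 : 0 < r := hδ.trans hr
    have : 0 < r ^ (1 + a) := Real.rpow_pos_of_pos hr0 _
    rw [Real.rpow_neg hr0.le, Real.norm_eq_abs, abs_div, abs_of_pos this, ← div_eq_mul_inv]
    gcongr
    exact hB r hr.le

lemma diff_eq {d : ℕ} {φ : Euc d → ℝ} (hφ : Continuous φ) (p : ℝ≥0∞) (hp : 1 ≤ p)
    (hN : eLpNorm φ p volume < ⊤) {δ a b : ℝ} (hδ : 0 < δ) (ha : 0 < a) (hb0 : 0 ≤ b) (x : Euc d) :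
    (∫ r in Set.Ioi δ, (doubleAvg φ (δ ^ (1 - b) * r ^ b) r x - φ x) / r ^ (1 + a))
      - ∫ r in Set.Ioi δ, (ballAvg φ r x - φ x) / r ^ (1 + a)
    = ∫ r in Set.Ioi δ, dgap φ (δ ^ (1 - b) * r ^ b) r x / r ^ (1 + a) := by
  obtain ⟨B, hB⟩ := avg_bound hφ p hp hN hδ
  have hεc : Continuous (fun r : ℝ => δ ^ (1 - b) * r ^ b) :=
    continuous_const.mul (Real.continuous_rpow_const hb0)
  have hε : ∀ r ∈ Ioi δ, 0 ≤ δ ^ (1 - b) * r ^ b := fun r hr =>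
    mul_nonneg (Real.rpow_nonneg hδ.le _) (Real.rpow_nonneg (hδ.trans hr).le _)
  have c1 : Continuous (fun q : ℝ × Euc d => ∫ w, φ (q.2 + q.1 • w) ∂(nu d)) :=
    nu_continuous (by fun_prop)
  have i1 : IntegrableOn (fun r => (ballAvg φ r x - φ x) / r ^ (1 + a)) (Ioi δ) := by
    refine IntegrableOn.congr_fun (f := fun r =>
      ((∫ w, φ (x + r • w) ∂(nu d)) - φ x) / r ^ (1 + a)) ?_ ?_ measurableSet_Ioi
    · refine tail_integrable (B := B + |φ x|) ?_ hδ ha ?_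
      · exact (c1.comp (f := fun r : ℝ => (r, x)) (by fun_prop)).sub continuous_const
      · intro r hr
        exact (abs_sub _ _).trans (add_le_add (hB r hr x) le_rfl)
    · intro r hr
      simp only [ballAvg_eq φ (hδ.trans hr).le]
  have i2 : IntegrableOn (fun r => (doubleAvg φ (δ ^ (1 - b) * r ^ b) r x - φ x) / r ^ (1 + a))
      (Ioi δ) := by
    refine IntegrableOn.congr_fun (f := fun r =>
      ((∫ z, (∫ w, φ (x + (δ ^ (1 - b) * r ^ b) • z + r • w) ∂(nu d)) ∂(nu d)) - φ x)
        / r ^ (1 + a)) ?_ ?_ measurableSet_Ioi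
    · refine tail_integrable (B := B + |φ x|) ?_ hδ ha ?_
      · refine Continuous.sub ?_ continuous_const
        apply nu_continuous
        exact c1.comp (f := fun q : ℝ × Euc d => (q.1, x + (δ ^ (1 - b) * q.1 ^ b) • q.2))
          (by fun_prop)
      · intro r hr
        refine (abs_sub _ _).trans (add_le_add ?_ le_rfl)
        have := norm_integral_le_of_norm_le_const (μ := nu d) (C := B)
          (f := fun z => ∫ w, φ (x + (δ ^ (1 - b) * r ^ b) • z + r • w) ∂(nu d))
          (Filter.Eventually.of_forall fun z => hB r hr _)
        simpa using this
    · intro r hr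
      simp only [doubleAvg_eq φ (hε r hr) (hδ.trans hr).le]
  rw [← integral_sub i2 i1]
  refine setIntegral_congr_fun measurableSet_Ioi fun r hr => ?_
  rw [← dgap_eq hφ (hε r hr) (hδ.trans hr).le]
  ring

/-- one-tail regime, stable case: with `a ∈ (0,2)`, `b ∈ [0,1)`,
`L^δ φ(x) = u₀ V₁ ∫_δ^∞ (φ̄̄(x, δ^{1−b} r^b, r) − φ(x)) dr/r^{1+a}` and
`D^δ φ(x) = u₀ V₁ ∫_δ^∞ (φ̄(x,r) − φ(x)) dr/r^{1+a}`, there exist `C > 0`, `θ > 0` such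
that for all `δ ∈ (0,1)` and all admissible `φ`,
`‖L^δ φ − D^δ φ‖_p ≤ C δ^θ max_{|κ|≤2} ‖∂_κ φ‖_p`. -/
theorem stmt16 (d : ℕ) (hd : 1 ≤ d) (u₀ : ℝ) (hu : 0 < u₀) (p : ℝ≥0∞) (hp : 1 ≤ p)
    (a b : ℝ) (ha0 : 0 < a) (ha2 : a < 2) (hb0 : 0 ≤ b) (hb1 : b < 1) :
    ∃ C : ℝ, 0 < C ∧ ∃ θ : ℝ, 0 < θ ∧
      ∀ δ : ℝ, 0 < δ → δ < 1 →
        ∀ φ : Euc d → ℝ, ContDiff ℝ 2 φ → maxDle 2 φ p < ⊤ →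
          eLpNorm (fun x =>
              (u₀ * V1 d *
                ∫ r in Set.Ioi δ, (doubleAvg φ (δ ^ (1 - b) * r ^ b) r x - φ x) / r ^ (1 + a))
              - u₀ * V1 d *
                ∫ r in Set.Ioi δ, (ballAvg φ r x - φ x) / r ^ (1 + a)) p volume
          ≤ ENNReal.ofReal (C * δ ^ θ) * maxDle 2 φ p := by
  obtain ⟨s, hsa, hs2, hsb⟩ : ∃ s : ℝ, a < s ∧ s ≤ 2 ∧ b * s < a := by
    refine ⟨min 2 (a * (2 - b)), lt_min ha2 (by nlinarith), min_le_left _ _, ?_⟩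
    calc b * min 2 (a * (2 - b)) ≤ b * (a * (2 - b)) := by gcongr; exact min_le_right _ _
      _ < a := by nlinarith [mul_pos ha0 (mul_pos (sub_pos.2 hb1) (sub_pos.2 hb1))]
  have hV : 0 < V1 d := ENNReal.toReal_pos (vol_ball_ne_zero d 0 one_pos) measure_ball_lt_top.ne
  have hab : 0 < a - b * s := by linarith
  refine ⟨u₀ * V1 d * (2 + d ^ 2) / (a - b * s), by positivity, s - a, by linarith, ?_⟩
  intro δ hδ _ φ hφ hmax
  have hφc := hφ.continuous
  have hN : eLpNorm φ p volume < ⊤ := (le_maxDle φ p [] (by simp)).trans_lt hmax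
  -- the weight
  set ε : ℝ → ℝ := fun r => δ ^ (1 - b) * r ^ b with hεdef
  have hεc : Continuous ε := continuous_const.mul (Real.continuous_rpow_const hb0)
  have hε : ∀ r ∈ Ioi δ, 0 < ε r := fun r hr =>
    mul_pos (Real.rpow_pos_of_pos hδ _) (Real.rpow_pos_of_pos (hδ.trans hr) _)
  set wt : ℝ → ℝ := fun r => ε r ^ s / r ^ (1 + a) with hwt
  have hwtm : Measurable wt :=
    (hεc.measurable.pow_const s).div (measurable_id.pow_const (1 + a))
  have hwt_eq : ∀ r ∈ Ioi δ, wt r = δ ^ ((1 - b) * s) * r ^ (b * s - (1 + a)) := by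
    intro r hr
    have hr0 : 0 < r := hδ.trans hr
    simp only [hwt, hεdef]
    rw [Real.mul_rpow (Real.rpow_nonneg hδ.le _) (Real.rpow_nonneg hr0.le _),
      ← Real.rpow_mul hδ.le, ← Real.rpow_mul hr0.le, Real.rpow_sub hr0]
    ring
  have hwt0 : ∀ r ∈ Ioi δ, 0 ≤ wt r := fun r hr =>
    div_nonneg (Real.rpow_nonneg (hε r hr).le _) (Real.rpow_nonneg (hδ.trans hr).le _)
  have hexp : b * s - (1 + a) < -1 := by linarith
  have hwti : IntegrableOn wt (Ioi δ) :=
    IntegrableOn.congr_fun ((integrableOn_Ioi_rpow_of_lt hexp hδ).const_mul _)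
      (fun r hr => (hwt_eq r hr).symm) measurableSet_Ioi
  have hwtI : ∫ r in Ioi δ, wt r = δ ^ (s - a) / (a - b * s) := by
    rw [setIntegral_congr_fun measurableSet_Ioi hwt_eq, integral_const_mul,
      integral_Ioi_rpow_of_lt hexp hδ]
    have e1 : b * s - (1 + a) + 1 = -(a - b * s) := by ring
    rw [e1, neg_div_neg_eq, mul_div_assoc', ← Real.rpow_add hδ]
    congr 2
    ring
  set μ : Measure ℝ := (volume.restrict (Ioi δ)).withDensity (fun r => ENNReal.ofReal (wt r)) with hμ
  have hμu : μ univ = ENNReal.ofReal (δ ^ (s - a) / (a - b * s)) := by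
    rw [hμ, withDensity_apply _ MeasurableSet.univ, Measure.restrict_univ, ← hwtI,
      ofReal_integral_eq_lintegral_ofReal hwti]
    filter_upwards [ae_restrict_mem measurableSet_Ioi] with r hr using hwt0 r hr
  have hfin : IsFiniteMeasure μ := ⟨by rw [hμu]; exact ENNReal.ofReal_lt_top⟩
  have hkey : (fun x => (u₀ * V1 d *
        ∫ r in Set.Ioi δ, (doubleAvg φ (δ ^ (1 - b) * r ^ b) r x - φ x) / r ^ (1 + a))
      - u₀ * V1 d * ∫ r in Set.Ioi δ, (ballAvg φ r x - φ x) / r ^ (1 + a))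
      = fun x => ∫ r, (u₀ * V1 d / ε r ^ s) * dgap φ (ε r) r x ∂μ := by
    ext x
    rw [← mul_sub, diff_eq hφc p hp hN hδ ha0 hb0, hμ,
      integral_withDensity_eq_integral_toReal_smul hwtm.ennreal_ofReal (by simp),
      ← integral_const_mul]
    refine setIntegral_congr_fun measurableSet_Ioi fun r hr => ?_
    have h1 : 0 < ε r ^ s := Real.rpow_pos_of_pos (hε r hr) _
    simp only [ENNReal.toReal_ofReal (hwt0 r hr), smul_eq_mul]
    simp only [hwt]
    field_simp
    simp only [hεdef]
  rw [hkey]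
  have hmeas : Measurable (Function.uncurry
      fun (r : ℝ) (x : Euc d) => (u₀ * V1 d / ε r ^ s) * dgap φ (ε r) r x) := by
    refine Measurable.mul ?_ ?_
    · exact measurable_const.div ((hεc.measurable.comp measurable_fst).pow_const s)
    · exact ((dgap_cont hφc).comp (f := fun q : ℝ × Euc d => (ε q.1, q.1, q.2))
        (by fun_prop)).measurable
  refine (minkowski μ volume _ hmeas p hp
    (ENNReal.ofReal (u₀ * V1 d * (2 + d ^ 2)) * maxDle 2 φ p) ?_).trans ?_
  · have hac : μ ≪ volume.restrict (Ioi δ) := withDensity_absolutelyContinuous _ _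
    refine hac.ae_le ?_
    filter_upwards [ae_restrict_mem measurableSet_Ioi] with r hr
    have h1 : 0 < ε r ^ s := Real.rpow_pos_of_pos (hε r hr) _
    have e : (fun x => (u₀ * V1 d / ε r ^ s) * dgap φ (ε r) r x)
        = (u₀ * V1 d / ε r ^ s) • dgap φ (ε r) r := rfl
    rw [e, eLpNorm_const_smul, Real.enorm_of_nonneg (by positivity)]
    refine (mul_le_mul' le_rfl ((dgap_norm hφc p hp _ _).trans
      (gap_norm hφ p hp (hε r hr) (ha0.trans hsa).le hs2))).trans ?_
    rw [← mul_assoc, ← ENNReal.ofReal_mul (by positivity)]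
    apply le_of_eq
    congr 2
    field_simp
  · rw [hμu, ← mul_assoc, ← ENNReal.ofReal_mul (by positivity)]
    apply le_of_eq
    congr 2
    field_simp

end
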